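/- Let n ≥ 1 and let Ω ⊆ ℂⁿ be a bounded open set. Let p, q ∈ Ω and let λ ∈ ℂ with λ ≠ 0. If every function f : ℂⁿ → ℂ that is holomorphic on Ω and square-integrable on Ω satisfies f(p) = λ · f(q), then p = q. -/

import Mathlib

open MeasureTheory

/-- A function that is bounded on a set of finite measure is square-integrable there. -/
lemma lintegral_nnnorm_sq_lt_top_of_bounded {α E : Type*} [MeasurableSpace α]
    [SeminormedAddCommGroup E] {μ : Measure α} {s : Set α} (hs : MeasurableSet s)
    (hμ : μ s < ⊤) {f : α → E} {C : NNReal} (hf : ∀ x ∈ s, ‖f x‖₊ ≤ C) :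
    (∫⁻ x in s, (‖f x‖₊ : ENNReal) ^ 2 ∂μ) < ⊤ := by
  calc (∫⁻ x in s, (‖f x‖₊ : ENNReal) ^ 2 ∂μ)
      ≤ ∫⁻ _ in s, (C : ENNReal) ^ 2 ∂μ := by
        refine setLIntegral_mono' hs fun x hx => ?_
        gcongr
        exact hf x hx
    _ = (C : ENNReal) ^ 2 * μ s := setLIntegral_const _ _
    _ < ⊤ := ENNReal.mul_lt_top (ENNReal.pow_lt_top ENNReal.coe_lt_top) hμ

/-- If `Ω ⊆ ℂⁿ` is a bounded open set, `p, q ∈ Ω`, and `λ ≠ 0` is such that every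
holomorphic square-integrable function `f` on `Ω` satisfies `f p = λ * f q`, then `p = q`. -/
theorem bergman_eval_proportional_implies_eq
    (n : ℕ) (hn : 1 ≤ n) (Ω : Set ((Fin n → ℂ)))
    (hΩopen : IsOpen Ω) (hΩbdd : Bornology.IsBounded Ω)
    (p q : (Fin n → ℂ)) (hp : p ∈ Ω) (hq : q ∈ Ω)
    (lam : ℂ) (hlam : lam ≠ 0)
    (h : ∀ f : (Fin n → ℂ) → ℂ, DifferentiableOn ℂ f Ω →
      (∫⁻ z in Ω, (‖f z‖₊ : ENNReal) ^ 2) < ⊤ → f p = lam * f q) :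
    p = q := by
  ext k
  have hbound : ∀ z ∈ Ω, ‖z k - p k‖₊ ≤ (Metric.diam Ω).toNNReal := fun z hz => by
    rw [← NNReal.coe_le_coe, coe_nnnorm, Real.coe_toNNReal _ Metric.diam_nonneg, ← dist_eq_norm]
    exact (dist_le_pi_dist z p k).trans (Metric.dist_le_diam_of_mem hΩbdd hz hp)
  have hk := h (fun z => z k - p k) (by fun_prop)
    (lintegral_nnnorm_sq_lt_top_of_bounded hΩopen.measurableSet hΩbdd.measure_lt_top hbound)
  have hzero : q k - p k = 0 := by simpa [hlam] using hk
  exact (sub_eq_zero.mp hzero).symm
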